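/- arXiv:2603.18033 — 3 statements merged into one kernel-verified Lean document; each statement's English description precedes it below -/
import Mathlib

section
/- Let E and F be real Banach spaces, let s ⊆ E be an open convex set, let m ≥ 1 be an integer and γ ∈ (0,1]. Suppose f : E → F is m times continuously Fréchet differentiable on s and its m-th derivative is γ-Hölder on s with constant K ≥ 0, i.e. ‖D^m f(x) − D^m f(y)‖ ≤ K·‖x − y‖^γ for all x, y ∈ s (norms of multilinear maps). Then for every x ∈ s and every h ∈ E with x + h ∈ s, ‖f(x+h) − Σ_{j=0}^{m} (1/j!)·D^j f(x)[h, …, h]‖ ≤ K·(Γ(γ+1)/Γ(m+γ+1))·‖h‖^{m+γ}. -/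
open scoped Nat

/-- Mean value estimate behind Taylor's formula: if `g (k + 1)` is the derivative of `g k` along
`[0, 1]` for `k < m` and `g m` deviates from `g m 0` by at most `C * t ^ γ`, then the Taylor
remainder of `g 0` is bounded by the `m`-fold iterated integral of `C * t ^ γ`. -/
theorem norm_sub_taylor_sum_le_of_norm_sub_le_rpow
    {F : Type*} [NormedAddCommGroup F] [NormedSpace ℝ F] {γ C : ℝ} (hγ : 0 < γ)
    (m : ℕ) (g : ℕ → ℝ → F)
    (hg : ∀ k < m, ∀ t ∈ Set.Icc (0 : ℝ) 1,
      HasDerivWithinAt (g k) (g (k + 1) t) (Set.Icc 0 1) t)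
    (hC : ∀ t ∈ Set.Icc (0 : ℝ) 1, ‖g m t - g m 0‖ ≤ C * t ^ γ) :
    ∀ t ∈ Set.Icc (0 : ℝ) 1,
      ‖g 0 t - ∑ j ∈ Finset.range (m + 1), (t ^ j * (j ! : ℝ)⁻¹) • g j 0‖ ≤
        C * (Real.Gamma (γ + 1) / Real.Gamma (m + γ + 1)) * t ^ ((m : ℝ) + γ) := by
  induction m generalizing g with
  | zero =>
    have hΓ : Real.Gamma (γ + 1) ≠ 0 := (Real.Gamma_pos_of_pos (by positivity)).ne'
    simpa [hΓ] using hC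
  | succ m ih =>
    have ih := ih (fun k => g (k + 1)) (fun k hk => hg (k + 1) (by omega)) hC
    have hsum (t : ℝ) : HasDerivAt
        (fun t : ℝ => ∑ j ∈ Finset.range (m + 1 + 1), (t ^ j * (j ! : ℝ)⁻¹) • g j 0)
        (∑ j ∈ Finset.range (m + 1), (t ^ j * (j ! : ℝ)⁻¹) • g (j + 1) 0) t := by
      simp only [Finset.sum_range_succ' _ (m + 1), pow_zero]
      refine (HasDerivAt.fun_sum fun j _ => ?_).add_const _
      refine HasDerivAt.smul_const ?_ (g (j + 1) 0)
      refine ((hasDerivAt_pow (j + 1) t).mul_const _).congr_deriv ?_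
      rw [Nat.factorial_succ]
      push_cast
      have : (j : ℝ) + 1 ≠ 0 := by positivity
      field_simp
    have hpos : 0 < (m : ℝ) + γ + 1 := by positivity
    have hB (t : ℝ) : HasDerivAt
        (fun t : ℝ => C * (Real.Gamma (γ + 1) / Real.Gamma ((m + 1 : ℕ) + γ + 1)) *
          t ^ (((m + 1 : ℕ) : ℝ) + γ))
        (C * (Real.Gamma (γ + 1) / Real.Gamma (m + γ + 1)) * t ^ ((m : ℝ) + γ)) t := by
      have hexp : ((m + 1 : ℕ) : ℝ) + γ = m + γ + 1 := by push_cast; ring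
      rw [hexp, Real.Gamma_add_one hpos.ne']
      refine ((Real.hasDerivAt_rpow_const (p := (m : ℝ) + γ + 1)
        (Or.inr (by linarith [m.cast_nonneg (α := ℝ)]))).const_mul _).congr_deriv ?_
      rw [add_sub_cancel_right]
      have := (Real.Gamma_pos_of_pos hpos).ne'
      field_simp
    have hderiv (t : ℝ) (ht : t ∈ Set.Icc (0 : ℝ) 1) :=
      (hg 0 m.succ_pos t ht).fun_sub (hsum t).hasDerivWithinAt
    refine image_norm_le_of_norm_deriv_right_le_deriv_boundary
      (fun t ht => (hderiv t ht).continuousWithinAt)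
      (fun t ht => (hderiv t (Set.Ico_subset_Icc_self ht)).mono_of_mem_nhdsWithin
        (Icc_mem_nhdsGE_of_mem ht)) ?_ hB
      (fun t ht => ih t (Set.Ico_subset_Icc_self ht))
    have hne : (m : ℝ) + 1 + γ ≠ 0 := by positivity
    simp [Finset.sum_range_succ' _ (m + 1), Real.zero_rpow hne]

/-- The derivative along a segment of an iterated derivative evaluated at the direction of the
segment. -/
theorem ContDiffOn.hasDerivWithinAt_iteratedFDerivWithin_segment
    {E F : Type*} [NormedAddCommGroup E] [NormedSpace ℝ E]
    [NormedAddCommGroup F] [NormedSpace ℝ F] {s : Set E} {m k : ℕ} {f : E → F}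
    (hf : ContDiffOn ℝ m f s) (hs : UniqueDiffOn ℝ s) (hk : k < m) {x h : E} {T : Set ℝ}
    (hT : Set.MapsTo (fun t : ℝ => x + t • h) T s) {t : ℝ} (ht : t ∈ T) :
    HasDerivWithinAt (fun t : ℝ => iteratedFDerivWithin ℝ k f s (x + t • h) (fun _ => h))
      (iteratedFDerivWithin ℝ (k + 1) f s (x + t • h) (fun _ => h)) T t := by
  have hline : HasDerivWithinAt (fun t : ℝ => x + t • h) h T t := by
    simpa using (((hasDerivAt_id t).smul_const h).const_add x).hasDerivWithinAt
  have hD := (hf.ftaylorSeriesWithin hs).fderivWithin k (by exact_mod_cast hk) _ (hT ht)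
  have hcomp := hD.comp_hasDerivWithinAt t hline hT
  exact ((ContinuousMultilinearMap.apply ℝ (fun _ : Fin k => E) F
    (fun _ => h)).hasFDerivAt.comp_hasDerivWithinAt t hcomp).congr_deriv <| by
      simp only [ContinuousMultilinearMap.apply_apply]
      change iteratedFDerivWithin ℝ (k + 1) f s (x + t • h) (Fin.cons h fun _ => h) = _
      congr 1
      ext i
      exact Fin.cases rfl (fun _ => rfl) i

/-- **Fractional Taylor expansion with Hölder remainder** (Lemma 4.1).
If `f` is `m` times continuously differentiable on an open convex set `s` and its `m`-th
derivative is `γ`-Hölder with constant `K` on `s`, then the Taylor remainder of order `m`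
at `x` is bounded by `K * (Γ(γ+1)/Γ(m+γ+1)) * ‖h‖^(m+γ)`. -/
theorem fractional_taylor_expansion
    {E F : Type*} [NormedAddCommGroup E] [NormedSpace ℝ E] [CompleteSpace E]
    [NormedAddCommGroup F] [NormedSpace ℝ F] [CompleteSpace F]
    (s : Set E) (hs_open : IsOpen s) (hs_conv : Convex ℝ s)
    (m : ℕ) (hm : 1 ≤ m) (γ : ℝ) (hγ0 : 0 < γ) (hγ1 : γ ≤ 1)
    (f : E → F) (K : ℝ) (hK : 0 ≤ K)
    (hf : ContDiffOn ℝ (m : ℕ∞) f s)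
    (hHolder : ∀ x ∈ s, ∀ y ∈ s,
      ‖iteratedFDerivWithin ℝ m f s x - iteratedFDerivWithin ℝ m f s y‖ ≤ K * ‖x - y‖ ^ γ)
    (x : E) (hx : x ∈ s) (h : E) (hxh : x + h ∈ s) :
    ‖f (x + h) - ∑ j ∈ Finset.range (m + 1),
        ((j ! : ℝ))⁻¹ • iteratedFDerivWithin ℝ j f s x (fun _ => h)‖ ≤
      K * (Real.Gamma (γ + 1) / Real.Gamma (m + γ + 1)) * ‖h‖ ^ ((m : ℝ) + γ) := by
  have hmaps : Set.MapsTo (fun t : ℝ => x + t • h) (Set.Icc 0 1) s :=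
    fun t ht => hs_conv.add_smul_mem hx hxh ht
  have hbound (t : ℝ) (ht : t ∈ Set.Icc (0 : ℝ) 1) :
      ‖iteratedFDerivWithin ℝ m f s (x + t • h) (fun _ => h) -
        iteratedFDerivWithin ℝ m f s (x + (0 : ℝ) • h) (fun _ => h)‖ ≤
      K * ‖h‖ ^ ((m : ℝ) + γ) * t ^ γ := by
    have hH := hHolder (x + t • h) (hmaps ht) x hx
    rw [add_sub_cancel_left, norm_smul, Real.norm_of_nonneg ht.1,
      Real.mul_rpow ht.1 (norm_nonneg h)] at hH
    rw [zero_smul, add_zero, ← sub_apply]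
    calc _ ≤ K * (t ^ γ * ‖h‖ ^ γ) * ∏ _i : Fin m, ‖h‖ :=
          ContinuousMultilinearMap.le_of_opNorm_le hH _
      _ = K * ‖h‖ ^ ((m : ℝ) + γ) * t ^ γ := by
          rw [Real.rpow_add_of_nonneg (norm_nonneg h) m.cast_nonneg hγ0.le, Real.rpow_natCast]
          simp only [Finset.prod_const, Finset.card_univ, Fintype.card_fin]
          ring
  have key := norm_sub_taylor_sum_le_of_norm_sub_le_rpow hγ0 m
    (fun k t => iteratedFDerivWithin ℝ k f s (x + t • h) (fun _ => h))
    (fun k hk t ht => ContDiffOn.hasDerivWithinAt_iteratedFDerivWithin_segment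
      (by exact_mod_cast hf) hs_open.uniqueDiffOn hk hmaps ht)
    hbound 1 (Set.right_mem_Icc.mpr zero_le_one)
  simp only [one_smul, zero_smul, add_zero, one_pow, one_mul, Real.one_rpow, mul_one,
    iteratedFDerivWithin_zero_apply] at key
  exact key.trans_eq (by ring)
end

section
/- Let E be a real normed vector space, Φ ∈ E, γ ∈ (0,1] and C ≥ 0. Let T : ℕ × ℕ → E be a doubly indexed family satisfying the Richardson–Romberg recurrence T(k,ℓ) = (4^ℓ·T(k,ℓ−1) − T(k−1,ℓ−1))/(4^ℓ − 1) for all ℓ ≥ 1 and k ≥ ℓ, and suppose ‖T(k,0) − Φ‖ ≤ C·2^{−k(1+γ)} for all k ∈ ℕ. Then for every ℓ ∈ ℕ and every k ≥ ℓ, ‖T(k,ℓ) − Φ‖ ≤ 3^ℓ · C · 2^{−k(1+γ)}. -/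
/-- One Richardson extrapolation step with weight `a > 1` amplifies errors by the absolute weights. -/
theorem norm_richardson_step_sub_le {E : Type*} [NormedAddCommGroup E] [NormedSpace ℝ E]
    {a : ℝ} (ha : 1 < a) (x y Φ : E) :
    ‖(a - 1)⁻¹ • (a • x - y) - Φ‖ ≤ (a - 1)⁻¹ * (a * ‖x - Φ‖ + ‖y - Φ‖) := by
  have ha' : 0 < a - 1 := sub_pos.2 ha
  have h : (a - 1)⁻¹ • (a • x - y) - Φ = (a - 1)⁻¹ • (a • (x - Φ) - (y - Φ)) := by
    rw [eq_inv_smul_iff₀ ha'.ne', smul_sub, smul_inv_smul₀ ha'.ne']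
    module
  rw [h, norm_smul, Real.norm_of_nonneg (inv_nonneg.2 ha'.le)]
  gcongr
  refine (norm_sub_le _ _).trans_eq ?_
  rw [norm_smul, Real.norm_of_nonneg (by linarith)]

/-- Halving the scale worsens the rate `2 ^ (-k * (1 + γ))` by a factor of at most `4`. -/
theorem two_rpow_neg_mul_le_four_mul {γ : ℝ} (hγ : γ ≤ 1) (k : ℕ) :
    (2 : ℝ) ^ (-(k : ℝ) * (1 + γ)) ≤ 4 * (2 : ℝ) ^ (-((k + 1 : ℕ) : ℝ) * (1 + γ)) := by
  have h4 : (4 : ℝ) = 2 ^ (2 : ℝ) := by norm_num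
  rw [h4, ← Real.rpow_add two_pos]
  apply Real.rpow_le_rpow_of_exponent_le one_le_two
  push_cast
  linarith

/-- **Abstract inductive core of the Quantum Romberg method** (Theorem 6.4).
If the doubly-indexed family `T` satisfies the Richardson–Romberg recurrence
`T(k,ℓ) = (4^ℓ T(k,ℓ−1) − T(k−1,ℓ−1))/(4^ℓ−1)` and the initial errors satisfy
`‖T(k,0) − Φ‖ ≤ C · 2^{−k(1+γ)}`, then at every level `ℓ` and all `k ≥ ℓ`,
`‖T(k,ℓ) − Φ‖ ≤ 3^ℓ · C · 2^{−k(1+γ)}`. -/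
theorem quantum_romberg_induction
    {E : Type*} [NormedAddCommGroup E] [NormedSpace ℝ E]
    (Φ : E) (γ C : ℝ) (hγ0 : 0 < γ) (hγ1 : γ ≤ 1) (hC : 0 ≤ C)
    (T : ℕ → ℕ → E)
    (hrec : ∀ ℓ k : ℕ, 1 ≤ ℓ → ℓ ≤ k →
      T k ℓ = ((4 : ℝ) ^ ℓ - 1)⁻¹ • (((4 : ℝ) ^ ℓ) • T k (ℓ - 1) - T (k - 1) (ℓ - 1)))
    (h0 : ∀ k : ℕ, ‖T k 0 - Φ‖ ≤ C * (2 : ℝ) ^ (-(k : ℝ) * (1 + γ)))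
    (ℓ k : ℕ) (hkl : ℓ ≤ k) :
    ‖T k ℓ - Φ‖ ≤ (3 : ℝ) ^ ℓ * C * (2 : ℝ) ^ (-(k : ℝ) * (1 + γ)) := by
  induction ℓ generalizing k with
  | zero => simpa using h0 k
  | succ ℓ ih =>
    obtain ⟨k, rfl⟩ : ∃ j, k = j + 1 := ⟨k - 1, by omega⟩
    have hx := ih (k + 1) (by omega)
    have hy := ih k (by omega)
    rw [hrec (ℓ + 1) (k + 1) (by omega) hkl]
    simp only [Nat.add_sub_cancel]
    have ha : (4 : ℝ) ≤ 4 ^ (ℓ + 1) := le_self_pow₀ (by norm_num) (Nat.succ_ne_zero ℓ)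
    have hr := two_rpow_neg_mul_le_four_mul hγ1 k
    generalize (4 : ℝ) ^ (ℓ + 1) = a at ha ⊢
    set r := (2 : ℝ) ^ (-((k + 1 : ℕ) : ℝ) * (1 + γ))
    have hr0 : 0 ≤ r := by positivity
    set M := (3 : ℝ) ^ ℓ * C
    have hM : 0 ≤ M := by positivity
    refine (norm_richardson_step_sub_le (by linarith) _ _ _).trans ?_
    rw [inv_mul_le_iff₀ (by linarith)]
    calc a * ‖T (k + 1) ℓ - Φ‖ + ‖T k ℓ - Φ‖
        ≤ a * (M * r) + M * (4 * r) := by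
          gcongr
          exact hy.trans (by gcongr)
      _ = (a + 4) * (M * r) := by ring
      _ ≤ ((a - 1) * 3) * (M * r) := by
          gcongr
          linarith
      _ = (a - 1) * (3 ^ (ℓ + 1) * C * r) := by
          simp only [M]
          ring
end

section
/- For every λ > 0 and every x ∈ ℝ with |x| ≥ 1, the kernel M_{1,λ}(x) = (1/4)·[tanh(λ(x+1)) − tanh(λ(x−1))] satisfies M_{1,λ}(x) ≤ (1/2)·e^{−2λ(|x|−1)}. -/
theorem one_sub_tanh_le_two_mul_exp (y : ℝ) :
    1 - Real.tanh y ≤ 2 * Real.exp (-(2 * y)) := by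
  have hexp : Real.exp (-(2 * y)) = Real.exp (-y) * Real.exp (-y) := by
    rw [← Real.exp_add]
    ring_nf
  have hinv : Real.exp y * Real.exp (-y) = 1 := by
    rw [← Real.exp_add, add_neg_cancel, Real.exp_zero]
  have hpos : 0 < Real.exp y + Real.exp (-y) := by positivity
  have hcube : 0 < Real.exp (-y) ^ 3 := by positivity
  rw [Real.tanh_eq, hexp, one_sub_div hpos.ne', div_le_iff₀ hpos]
  linear_combination 2 * hcube.le - 2 * Real.exp (-y) * hinv

/-- **Exponential tail bound for the symmetrized quantum density function** (q = 1).
For every `λ > 0` and `|x| ≥ 1`,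
`M_{1,λ}(x) = (1/4)·[tanh(λ(x+1)) − tanh(λ(x−1))] ≤ (1/2)·e^{−2λ(|x|−1)}`. -/
theorem M_one_lam_tail_bound (lam : ℝ) (hlam : 0 < lam) (x : ℝ) (hx : 1 ≤ |x|) :
    (1 / 4) * (Real.tanh (lam * (x + 1)) - Real.tanh (lam * (x - 1))) ≤
      (1 / 2) * Real.exp (-(2 * lam * (|x| - 1))) := by
  have htail := one_sub_tanh_le_two_mul_exp (lam * (|x| - 1))
  rw [← mul_assoc] at htail
  rcases abs_cases x with ⟨h, -⟩ | ⟨h, -⟩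
  · rw [h] at htail ⊢
    linarith [Real.tanh_lt_one (lam * (x + 1))]
  · rw [h] at htail ⊢
    rw [show lam * (x + 1) = -(lam * (-x - 1)) by ring, Real.tanh_neg]
    linarith [Real.neg_one_lt_tanh (lam * (x - 1))]
end
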